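/- Let W be a nonconfocal linear family of bisectors, i.e., for every nonzero f₀ ∈ V there exists h ∈ W with h f₀ ≠ 0. Then there exists an injective ℝ-linear map f : W → V, unique up to multiplication by a nonzero complex scalar, such that h(f(h)) = 0 for all h ∈ W. Moreover, letting U denote the ℂ-linear span of f(W): either U = V, in which case dim_ℝ W = 3 and ⟨f(h), f(h')⟩ ∈ ℝ for all h, h' ∈ W (f(W) is totally real); or dim_ℂ U = 2 and ⟨h u, u'⟩ = 0 for all h ∈ W and all u, u' ∈ U (the bisectors of the family share the common slice ℙ(U)). -/

import Mathlib

open scoped ComplexConjugate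

noncomputable section

/-- `V` is `ℂ³`. -/
abbrev V3 : Type := Fin 3 → ℂ

/-- The hermitian form of signature `(2,1)`:
`⟨x,y⟩ = x₀·conj y₀ + x₁·conj y₁ − x₂·conj y₂`. -/
def herm (x y : V3) : ℂ := x 0 * conj (y 0) + x 1 * conj (y 1) - x 2 * conj (y 2)

/-- The complex projective plane `ℙ(V)`. -/
abbrev PV : Type := Projectivization ℂ V3

/-- The class `[v]` of a nonzero vector `v` in `ℙ(V)`. -/
def projMk (v : V3) (hv : v ≠ 0) : PV := Projectivization.mk ℂ v hv

/-- A map `h` is self-adjoint (`h* = h`) w.r.t. the hermitian form. -/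
def SelfAdj (h : Module.End ℂ V3) : Prop := ∀ x y : V3, herm (h x) y = herm x (h y)

/-- The set `B_h = {[v] ∈ ℙ(V) | ⟨h v, v⟩ = 0}`. -/
def Bset (h : Module.End ℂ V3) : Set PV :=
  {q | ∃ v : V3, ∃ hv : v ≠ 0, q = projMk v hv ∧ herm (h v) v = 0}

/-- `h` defines a bisector: self-adjoint, trace `0`, rank `2`, and `B_h` contains
a point other than the focus (i.e. a point `[v]` with `h v ≠ 0`). -/
def IsBisector (h : Module.End ℂ V3) : Prop :=
  SelfAdj h ∧ LinearMap.trace ℂ V3 h = 0 ∧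
    Module.finrank ℂ (LinearMap.range h) = 2 ∧ ∃ v : V3, herm (h v) v = 0 ∧ h v ≠ 0

/-- A linear family of bisectors: an `ℝ`-subspace of self-adjoint traceless
degenerate maps whose base contains a negative point. -/
def IsLinearFamily (W : Submodule ℝ (Module.End ℂ V3)) : Prop :=
  (∀ h ∈ W, SelfAdj h ∧ LinearMap.trace ℂ V3 h = 0 ∧ LinearMap.det h = 0) ∧
    ∃ v : V3, ∃ hv : v ≠ 0, (herm v v).re < 0 ∧ ∀ h ∈ W, herm (h v) v = 0

/-- The map `x ↦ ⟨x,p⟩·p`. -/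
def wmap (p : V3) : Module.End ℂ V3 where
  toFun x := herm x p • p
  map_add' x y := by
    show herm (x + y) p • p = herm x p • p + herm y p • p
    have : herm (x + y) p = herm x p + herm y p := by
      simp only [herm, Pi.add_apply]; ring
    rw [this, add_smul]
  map_smul' c x := by
    show herm (c • x) p • p = c • (herm x p • p)
    have : herm (c • x) p = c * herm x p := by
      simp only [herm, Pi.smul_apply, smul_eq_mul]; ring
    rw [this, mul_smul]

/-- `ℙ(U)` for a complex subspace `U`. -/
def projC (U : Submodule ℂ V3) : Set PV :=
  {q | ∃ v : V3, ∃ hv : v ≠ 0, v ∈ U ∧ q = projMk v hv}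

/-- `ℙ(T)` for a real subspace `T`. -/
def projR (T : Submodule ℝ V3) : Set PV :=
  {q | ∃ v : V3, ∃ hv : v ≠ 0, v ∈ T ∧ q = projMk v hv}

/-- An `ℝ`-plane: `ℙ(T)` for a totally real `3`-dimensional real subspace `T`
with `ℂ·T = V`. -/
def IsRealPlane (T : Submodule ℝ V3) : Prop :=
  Module.finrank ℝ T = 3 ∧ Submodule.span ℂ (T : Set V3) = ⊤ ∧
    ∀ t ∈ T, ∀ t' ∈ T, (herm t t').im = 0

/-- A geodesic: `ℙ(W₀)` for a `2`-dimensional real subspace `W₀` on which the form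
is real-valued and not identically zero. -/
def IsGeodesic (W₀ : Submodule ℝ V3) : Prop :=
  Module.finrank ℝ W₀ = 2 ∧ (∀ w ∈ W₀, ∀ w' ∈ W₀, (herm w w').im = 0) ∧
    ∃ w ∈ W₀, ∃ w' ∈ W₀, herm w w' ≠ 0

/-- The real spine `R = {[h v] | [v] ∈ B_h, h v ≠ 0}` of `B_h`. -/
def RealSpine (h : Module.End ℂ V3) : Set PV :=
  {q | ∃ v : V3, ∃ hnz : h v ≠ 0, herm (h v) v = 0 ∧ q = projMk (h v) hnz}

/-- The orthogonal complement w.r.t. the hermitian form. -/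
def hermOrth (U : Submodule ℂ V3) : Submodule ℂ V3 where
  carrier := {x | ∀ u ∈ U, herm x u = 0}
  add_mem' := by
    intro a b ha hb u hu
    have h1 : herm (a + b) u = herm a u + herm b u := by
      simp only [herm, Pi.add_apply]; ring
    rw [h1, ha u hu, hb u hu, add_zero]
  zero_mem' := by
    intro u hu
    simp [herm]
  smul_mem' := by
    intro c x hx u hu
    have h1 : herm (c • x) u = c * herm x u := by
      simp only [herm, Pi.smul_apply, smul_eq_mul]; ring
    rw [h1, hx u hu, mul_zero]


lemma herm_add_left (x y w : V3) : herm (x + y) w = herm x w + herm y w := by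
  simp only [herm, Pi.add_apply]; ring

lemma herm_add_right (x y w : V3) : herm x (y + w) = herm x y + herm x w := by
  simp only [herm, Pi.add_apply, map_add]; ring

lemma herm_smul_left (c : ℂ) (x y : V3) : herm (c • x) y = c * herm x y := by
  simp only [herm, Pi.smul_apply, smul_eq_mul]; ring

lemma herm_smul_right (c : ℂ) (x y : V3) : herm x (c • y) = conj c * herm x y := by
  simp only [herm, Pi.smul_apply, smul_eq_mul, map_mul]; ring

lemma herm_neg_left (x y : V3) : herm (-x) y = -herm x y := by
  simp only [herm, Pi.neg_apply]; ring

lemma herm_neg_right (x y : V3) : herm x (-y) = -herm x y := by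
  simp only [herm, Pi.neg_apply, map_neg]; ring

lemma herm_sub_left (x y w : V3) : herm (x - y) w = herm x w - herm y w := by
  simp only [herm, Pi.sub_apply]; ring

@[simp] lemma herm_zero_left (x : V3) : herm 0 x = 0 := by simp [herm]

@[simp] lemma herm_zero_right (x : V3) : herm x 0 = 0 := by simp [herm]

lemma conj_herm (x y : V3) : conj (herm x y) = herm y x := by
  simp only [herm, map_sub, map_add, map_mul, Complex.conj_conj]; ring

lemma herm_eq_zero_symm {x y : V3} (h : herm x y = 0) : herm y x = 0 := by
  rw [← conj_herm, h, map_zero]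

lemma eq_zero_of_herm_eq_zero {x : V3} (h : ∀ y, herm x y = 0) : x = 0 := by
  ext i
  have := h (Pi.single i 1)
  fin_cases i <;> simpa [herm] using this

/-- A vector orthogonal to a negative vector cannot be isotropic unless it vanishes. -/
lemma eq_zero_of_orthogonal_negative {v n : V3} (hv : (herm v v).re < 0)
    (hn : herm n n = 0) (hvn : herm v n = 0) : n = 0 := by
  have key : ∀ z : ℂ, (z * conj z) = ((‖z‖ ^ 2 : ℝ) : ℂ) := fun z => by
    rw [Complex.mul_conj, Complex.normSq_eq_norm_sq]
  have hv' : ‖v 0‖ ^ 2 + ‖v 1‖ ^ 2 < ‖v 2‖ ^ 2 := by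
    simp only [herm, key] at hv
    norm_cast at hv
    linarith
  have hn' : ‖n 0‖ ^ 2 + ‖n 1‖ ^ 2 = ‖n 2‖ ^ 2 := by
    simp only [herm, key] at hn
    norm_cast at hn
    linarith
  have hle : ‖v 2‖ * ‖n 2‖ ≤ ‖v 0‖ * ‖n 0‖ + ‖v 1‖ * ‖n 1‖ := by
    have h1 : v 2 * conj (n 2) = v 0 * conj (n 0) + v 1 * conj (n 1) := by
      simp only [herm] at hvn
      linear_combination -hvn
    have h2 := norm_add_le (v 0 * conj (n 0)) (v 1 * conj (n 1))
    rw [← h1] at h2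
    simpa only [norm_mul, RCLike.norm_conj] using h2
  have hsq : (‖v 2‖ * ‖n 2‖) ^ 2 ≤ (‖v 0‖ ^ 2 + ‖v 1‖ ^ 2) * ‖n 2‖ ^ 2 := by
    have h1 := pow_le_pow_left₀ (by positivity) hle 2
    rw [← hn']
    nlinarith [sq_nonneg (‖v 0‖ * ‖n 1‖ - ‖v 1‖ * ‖n 0‖)]
  have h2 : ‖n 2‖ ^ 2 = 0 := by
    by_contra hne
    have : 0 < ‖n 2‖ ^ 2 := lt_of_le_of_ne (by positivity) (Ne.symm hne)
    nlinarith
  have h0 : ‖n 0‖ ^ 2 = 0 := by nlinarith [sq_nonneg ‖n 0‖, sq_nonneg ‖n 1‖]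
  have h1 : ‖n 1‖ ^ 2 = 0 := by nlinarith [sq_nonneg ‖n 0‖, sq_nonneg ‖n 1‖]
  ext i
  fin_cases i <;> simp_all

lemma exists_coords {f g w : V3} (hb : LinearIndependent ℂ ![f, g, w]) (x : V3) :
    ∃ a b c : ℂ, x = a • f + b • g + c • w := by
  have hs : Submodule.span ℂ (Set.range ![f, g, w]) = ⊤ :=
    hb.span_eq_top_of_card_eq_finrank' (by simp)
  have hx : x ∈ Submodule.span ℂ (Set.range ![f, g, w]) := hs ▸ Submodule.mem_top
  obtain ⟨c, hc⟩ := (Submodule.mem_span_range_iff_exists_fun ℂ).1 hx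
  exact ⟨c 0, c 1, c 2, by simpa [Fin.sum_univ_three] using hc.symm⟩

lemma eq_zero_of_orthogonal_basis {f g w x : V3} (hb : LinearIndependent ℂ ![f, g, w])
    (hf : herm x f = 0) (hg : herm x g = 0) (hw : herm x w = 0) : x = 0 := by
  refine eq_zero_of_herm_eq_zero fun y => ?_
  obtain ⟨a, b, c, rfl⟩ := exists_coords hb y
  simp [herm_add_right, herm_smul_right, hf, hg, hw]

lemma exists_linearIndependent_triple {f g : V3} (h : LinearIndependent ℂ ![f, g]) :
    ∃ w, LinearIndependent ℂ ![f, g, w] := by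
  obtain ⟨w, hw⟩ := exists_linearIndependent_snoc_of_lt_finrank h (by simp)
  have hs : (Fin.snoc ![f, g] w : Fin 3 → V3) = ![f, g, w] := by simp
  exact ⟨w, hs ▸ hw⟩

lemma exists_smul_of_orthogonal_pair {f g n x : V3} (h : LinearIndependent ℂ ![f, g])
    (hn : n ≠ 0) (hnf : herm n f = 0) (hng : herm n g = 0)
    (hxf : herm x f = 0) (hxg : herm x g = 0) : ∃ c : ℂ, x = c • n := by
  obtain ⟨w, hb⟩ := exists_linearIndependent_triple h
  have hnw : herm n w ≠ 0 := fun h0 => hn (eq_zero_of_orthogonal_basis hb hnf hng h0)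
  refine ⟨herm x w / herm n w, sub_eq_zero.1 (eq_zero_of_orthogonal_basis hb ?_ ?_ ?_)⟩ <;>
    simp [herm_sub_left, herm_smul_left, *]

lemma exists_comb_of_orthogonal {f g n x : V3} (h : LinearIndependent ℂ ![f, g])
    (hn : n ≠ 0) (hnf : herm n f = 0) (hng : herm n g = 0) (hx : herm n x = 0) :
    ∃ a b : ℂ, x = a • f + b • g := by
  obtain ⟨w, hb⟩ := exists_linearIndependent_triple h
  have hnw : herm n w ≠ 0 := fun h0 => hn (eq_zero_of_orthogonal_basis hb hnf hng h0)
  obtain ⟨a, b, c, rfl⟩ := exists_coords hb x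
  have hc : c = 0 := by simpa [herm_add_right, herm_smul_right, hnf, hng, hnw] using hx
  exact ⟨a, b, by simp [hc]⟩

lemma linearIndependent_pair_of_not_smul {f g : V3} (hf : f ≠ 0) (h : ∀ c : ℂ, g ≠ c • f) :
    LinearIndependent ℂ ![f, g] := by
  rw [LinearIndependent.pair_iff' hf]
  exact fun a ha => h a ha.symm

lemma linearIndependent_triple_of_not_comb {f g w : V3} (hfg : LinearIndependent ℂ ![f, g])
    (h : ∀ a b : ℂ, w ≠ a • f + b • g) : LinearIndependent ℂ ![f, g, w] := by
  have hs : (Fin.snoc ![f, g] w : Fin 3 → V3) = ![f, g, w] := by simp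
  rw [← hs, linearIndependent_finSnoc]
  refine ⟨hfg, fun hw => ?_⟩
  obtain ⟨c, hc⟩ := (Submodule.mem_span_range_iff_exists_fun ℂ).1 hw
  exact h (c 0) (c 1) (by simpa [Fin.sum_univ_two] using hc.symm)

lemma trace_rank_one (c : ℂ) (n : V3) (h : Module.End ℂ V3)
    (hh : ∀ x, h x = (c * herm x n) • n) : LinearMap.trace ℂ V3 h = c * herm n n := by
  rw [LinearMap.trace_eq_matrix_trace ℂ (Pi.basisFun ℂ (Fin 3))]
  simp [Matrix.trace, Fin.sum_univ_three, hh, herm]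
  ring

/-- In a linear family, the kernel of a nonzero member is a complex line. -/
lemma exists_smul_of_mem_ker {h : Module.End ℂ V3} (hs : SelfAdj h)
    (htr : LinearMap.trace ℂ V3 h = 0) {v : V3} (hv : (herm v v).re < 0)
    (hhv : herm (h v) v = 0) (h0 : h ≠ 0) {f g : V3} (hf0 : f ≠ 0)
    (hf : h f = 0) (hg : h g = 0) : ∃ c : ℂ, g = c • f := by
  by_contra! hne
  have hfg := linearIndependent_pair_of_not_smul hf0 hne
  obtain ⟨w, hb⟩ := exists_linearIndependent_triple hfg
  set n := h w with hn
  have hn0 : n ≠ 0 := by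
    intro hn0
    refine h0 (LinearMap.ext fun x => ?_)
    obtain ⟨a, b, c, rfl⟩ := exists_coords hb x
    simp [hf, hg, ← hn, hn0]
  have hnf : herm n f = 0 := by rw [hs, hf, herm_zero_right]
  have hng : herm n g = 0 := by rw [hs, hg, herm_zero_right]
  have hnw : herm n w ≠ 0 := fun h' => hn0 (eq_zero_of_orthogonal_basis hb hnf hng h')
  have hwn : herm w n ≠ 0 := fun h' => hnw (herm_eq_zero_symm h')
  have hh : ∀ x, h x = ((herm w n)⁻¹ * herm x n) • n := by
    intro x
    obtain ⟨a, b, c, rfl⟩ := exists_coords hb x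
    simp only [map_add, map_smul, hf, hg, ← hn, herm_add_left, herm_smul_left,
      herm_eq_zero_symm hnf, herm_eq_zero_symm hng]
    simp only [smul_zero, mul_zero, zero_add]
    congr 1
    field_simp
  have hnn : herm n n = 0 := by
    rw [trace_rank_one _ n h hh] at htr
    simpa [hwn] using htr
  have hvn : herm v n = 0 := by
    rw [hh, herm_smul_left, ← conj_herm v n] at hhv
    simpa [hwn] using hhv
  exact hn0 (eq_zero_of_orthogonal_negative hv hnn hvn)

lemma exists_ker_of_det_eq_zero {h : Module.End ℂ V3} (hd : LinearMap.det h = 0) :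
    ∃ f, f ≠ 0 ∧ h f = 0 := by
  obtain ⟨f, hf, hf0⟩ := Submodule.exists_mem_ne_zero_of_ne_bot
    (LinearMap.bot_lt_ker_of_det_eq_zero hd).ne'
  exact ⟨f, hf0, hf⟩

lemma det_form_eq_zero {h : Module.End ℂ V3} (hd : LinearMap.det h = 0) {e : Fin 3 → V3}
    (hb : LinearIndependent ℂ e) : (Matrix.of fun i j => herm (h (e i)) (e j)).det = 0 := by
  obtain ⟨x, hx0, hx⟩ := exists_ker_of_det_eq_zero hd
  have he : e = ![e 0, e 1, e 2] := by ext i j; fin_cases i <;> rfl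
  obtain ⟨a, b, c, rfl⟩ := exists_coords (he ▸ hb) x
  refine Matrix.exists_vecMul_eq_zero_iff.1 ⟨![a, b, c], fun h0 => hx0 ?_, ?_⟩
  · have h1 := congrFun h0 0
    have h2 := congrFun h0 1
    have h3 := congrFun h0 2
    simp at h1 h2 h3
    simp [h1, h2, h3]
  · ext j
    have := congrArg (herm · (e j)) hx
    simpa [Matrix.vecMul, dotProduct, Fin.sum_univ_three, herm_add_left, herm_smul_left]
      using this

/-- First variation of the determinant: if `h` and all `h + t • k` are degenerate and
`h` has kernel `ℂ·f`, then the form of `k` vanishes at `f`. -/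
lemma herm_ker_eq_zero {h k : Module.End ℂ V3} (hs : SelfAdj h) {f : V3} (hf0 : f ≠ 0)
    (hf : h f = 0) (hker : ∀ g, h g = 0 → ∃ c : ℂ, g = c • f)
    (hd : ∀ t : ℝ, LinearMap.det (h + t • k) = 0) : herm (k f) f = 0 := by
  obtain ⟨g, hfg⟩ : ∃ g, LinearIndependent ℂ ![f, g] :=
    exists_linearIndependent_pair_of_one_lt_finrank (by simp) hf0
  obtain ⟨w, hb⟩ := exists_linearIndependent_triple hfg
  have hcol : ∀ x, herm (h x) f = 0 := fun x => by rw [hs, hf, herm_zero_right]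
  have hδ : herm (h g) g * herm (h w) w - herm (h g) w * herm (h w) g ≠ 0 := by
    intro hδ
    have hdet : (!![herm (h g) g, herm (h g) w; herm (h w) g, herm (h w) w]).det = 0 := by
      rw [Matrix.det_fin_two_of, hδ]
    obtain ⟨c, hc0, hc⟩ := Matrix.exists_vecMul_eq_zero_iff.2 hdet
    have hc1 := congrFun hc 0
    have hc2 := congrFun hc 1
    simp [Matrix.vecMul, dotProduct, Fin.sum_univ_two] at hc1 hc2
    have hz : h (c 0 • g + c 1 • w) = 0 := by
      refine eq_zero_of_orthogonal_basis hb (hcol _) ?_ ?_ <;>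
        simpa [herm_add_left, herm_smul_left]
    obtain ⟨a, ha⟩ := hker _ hz
    have := Fintype.linearIndependent_iff.1 hb ![-a, c 0, c 1] (by
      simp [Fin.sum_univ_three, ← ha])
    refine hc0 ?_
    ext i
    fin_cases i
    · simpa using this 1
    · simpa using this 2
  have hdet : ∀ t : ℝ, _ := fun t => det_form_eq_zero (hd t) hb
  simp only [Matrix.det_fin_three, Matrix.of_apply, LinearMap.add_apply, LinearMap.smul_apply,
    herm_add_left, ← Complex.coe_smul, herm_smul_left, Matrix.cons_val_zero,
    Matrix.cons_val_one, Matrix.cons_val, hcol, hf, herm_zero_left] at hdet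
  have h1 := hdet 1
  have h2 := hdet (-1)
  have h3 := hdet 2
  push_cast at h1 h2 h3
  have : herm (k f) f * (herm (h g) g * herm (h w) w - herm (h g) w * herm (h w) g) = 0 := by
    linear_combination h1 - h2 / 3 - h3 / 6
  exact (mul_eq_zero.1 this).resolve_right hδ

/-- The linear functionals `⟨·, a⟩`, `⟨·, b⟩`, `⟨·, c⟩` assembled into one map. -/
def hermTriple (a b c : V3) : V3 →ₗ[ℂ] V3 where
  toFun x := ![herm x a, herm x b, herm x c]
  map_add' x y := by ext i; fin_cases i <;> simp [herm_add_left]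
  map_smul' t x := by ext i; fin_cases i <;> simp [herm_smul_left]

lemma exists_herm_eq {a b c : V3}
    (hinj : ∀ x, herm x a = 0 → herm x b = 0 → herm x c = 0 → x = 0) (p q r : ℂ) :
    ∃ x, herm x a = p ∧ herm x b = q ∧ herm x c = r := by
  have hi : Function.Injective (hermTriple a b c) := by
    rw [← LinearMap.ker_eq_bot, LinearMap.ker_eq_bot']
    intro x hx
    exact hinj x (by simpa [hermTriple] using congrFun hx 0)
      (by simpa [hermTriple] using congrFun hx 1) (by simpa [hermTriple] using congrFun hx 2)
  obtain ⟨x, hx⟩ := LinearMap.injective_iff_surjective.1 hi ![p, q, r]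
  exact ⟨x, by simpa [hermTriple] using congrFun hx 0,
    by simpa [hermTriple] using congrFun hx 1, by simpa [hermTriple] using congrFun hx 2⟩

/-- The consequences of `IsLinearFamily` used to construct the focal embedding: members are
self-adjoint, traceless and degenerate, and nonzero members have rank exactly two. -/
structure IsRankTwoFamily (W : Submodule ℝ (Module.End ℂ V3)) : Prop where
  selfAdj : ∀ h ∈ W, SelfAdj h
  trace_eq : ∀ h ∈ W, LinearMap.trace ℂ V3 h = 0
  det_eq : ∀ h ∈ W, LinearMap.det h = 0
  ker_line : ∀ h ∈ W, h ≠ 0 → ∀ f, f ≠ 0 → h f = 0 → ∀ g, h g = 0 → ∃ c : ℂ, g = c • f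

lemma IsLinearFamily.isRankTwoFamily {W : Submodule ℝ (Module.End ℂ V3)}
    (hW : IsLinearFamily W) : IsRankTwoFamily W := by
  obtain ⟨hW, v, -, hv, hB⟩ := hW
  exact ⟨fun h hh => (hW h hh).1, fun h hh => (hW h hh).2.1, fun h hh => (hW h hh).2.2,
    fun h hh h0 f hf0 hf g hg => exists_smul_of_mem_ker (hW h hh).1 (hW h hh).2.1 hv
      (hB h hh) h0 hf0 hf hg⟩

namespace IsRankTwoFamily

variable {W : Submodule ℝ (Module.End ℂ V3)}

lemma herm_ker (hW : IsRankTwoFamily W) {h k : Module.End ℂ V3} (hh : h ∈ W) (hk : k ∈ W)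
    (h0 : h ≠ 0) {f : V3} (hf : h f = 0) : herm (k f) f = 0 := by
  rcases eq_or_ne f 0 with rfl | hf0
  · simp
  · exact herm_ker_eq_zero (hW.selfAdj h hh) hf0 hf (hW.ker_line h hh h0 f hf0 hf)
      fun t => hW.det_eq _ (W.add_mem hh (W.smul_mem t hk))

end IsRankTwoFamily

/-- Two members of a family with distinct foci `f` and `g`, normalized so that
`f + g` is the focus of their sum. -/
structure FocalPair (W : Submodule ℝ (Module.End ℂ V3)) (h k : Module.End ℂ V3) (f g : V3) :
    Prop where
  left_mem : h ∈ W
  right_mem : k ∈ W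
  indep : LinearIndependent ℂ ![f, g]
  left_focus : h f = 0
  right_focus : k g = 0
  cross : h g = -k f
  cross_ne : k f ≠ 0

lemma IsRankTwoFamily.exists_focalPair {W : Submodule ℝ (Module.End ℂ V3)}
    (hW : IsRankTwoFamily W) (hnc : ∀ f₀ : V3, f₀ ≠ 0 → ∃ h ∈ W, h f₀ ≠ 0) :
    ∃ h k f g, FocalPair W h k f g := by
  obtain ⟨h, hh, hne⟩ := hnc (fun _ => 1) (fun h0 => one_ne_zero (congrFun h0 0))
  have h0 : h ≠ 0 := by rintro rfl; exact hne rfl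
  obtain ⟨f, hf0, hf⟩ := exists_ker_of_det_eq_zero (hW.det_eq h hh)
  obtain ⟨k, hk, hkf⟩ := hnc f hf0
  have k0 : k ≠ 0 := by rintro rfl; exact hkf rfl
  obtain ⟨g, hg0, hg⟩ := exists_ker_of_det_eq_zero (hW.det_eq k hk)
  have hfg : LinearIndependent ℂ ![f, g] := by
    refine linearIndependent_pair_of_not_smul hf0 fun c hc => ?_
    rw [hc, map_smul, smul_eq_zero] at hg
    rcases hg with rfl | hg
    · exact hg0 (by simpa using hc)
    · exact hkf hg
  have hhg : h g ≠ 0 := by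
    intro hhg
    obtain ⟨c, hc⟩ := hW.ker_line h hh h0 f hf0 hf g hhg
    exact (LinearIndependent.pair_iff' hf0).1 hfg c hc.symm
  obtain ⟨c, hc⟩ := exists_smul_of_orthogonal_pair hfg hhg
    (by rw [hW.selfAdj h hh, hf, herm_zero_right]) (hW.herm_ker hk hh k0 hg)
    (hW.herm_ker hh hk h0 hf) (by rw [hW.selfAdj k hk, hg, herm_zero_right])
  have hc0 : c ≠ 0 := by rintro rfl; exact hkf (by simpa using hc)
  refine ⟨h, k, f, (-c) • g, hh, hk, ?_, hf, by simp [hg], by simp [hc], hkf⟩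
  rw [LinearIndependent.pair_iff' hf0] at hfg ⊢
  intro a ha
  refine hfg ((-c)⁻¹ * a) ?_
  rw [mul_smul, ha, smul_smul, inv_mul_cancel₀ (neg_ne_zero.2 hc0), one_smul]

namespace FocalPair

variable {W : Submodule ℝ (Module.End ℂ V3)} {h k : Module.End ℂ V3} {f g : V3}

lemma left_ne (p : FocalPair W h k f g) : h ≠ 0 := by
  rintro rfl
  exact p.cross_ne (by simpa using p.cross.symm)

lemma right_ne (p : FocalPair W h k f g) : k ≠ 0 := by
  rintro rfl
  exact p.cross_ne rfl

lemma focus_ne (p : FocalPair W h k f g) : f ≠ 0 := by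
  rintro rfl
  exact p.cross_ne (map_zero k)

lemma eq_zero (p : FocalPair W h k f g) (hW : IsRankTwoFamily W) {x : V3}
    (hx : h x = 0) (kx : k x = 0) : x = 0 := by
  obtain ⟨c, rfl⟩ := hW.ker_line h p.left_mem p.left_ne f p.focus_ne p.left_focus x hx
  rw [map_smul, smul_eq_zero] at kx
  rw [kx.resolve_right p.cross_ne, zero_smul]

lemma cross_left (p : FocalPair W h k f g) (hW : IsRankTwoFamily W) : herm (k f) f = 0 :=
  hW.herm_ker p.left_mem p.right_mem p.left_ne p.left_focus

lemma cross_right (p : FocalPair W h k f g) (hW : IsRankTwoFamily W) : herm (k f) g = 0 := by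
  rw [hW.selfAdj k p.right_mem, p.right_focus, herm_zero_right]

lemma herm_add_herm (p : FocalPair W h k f g) (hW : IsRankTwoFamily W)
    {m : Module.End ℂ V3} (hm : m ∈ W) : herm (m f) g + herm (m g) f = 0 := by
  have hne : h + k ≠ 0 := by
    intro h0
    have := LinearMap.congr_fun h0 f
    simp [p.left_focus, p.cross_ne] at this
  have hz : (h + k) (f + g) = 0 := by simp [p.left_focus, p.right_focus, p.cross]
  have hs := hW.herm_ker (W.add_mem p.left_mem p.right_mem) hm hne hz
  have h1 := hW.herm_ker p.left_mem hm p.left_ne p.left_focus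
  have h2 := hW.herm_ker p.right_mem hm p.right_ne p.right_focus
  simp only [map_add, herm_add_left, herm_add_right] at hs
  linear_combination hs - h1 - h2

lemma exists_solution (p : FocalPair W h k f g) (hW : IsRankTwoFamily W)
    {m : Module.End ℂ V3} (hm : m ∈ W) : ∃ x, h x = -m f ∧ k x = -m g := by
  have sh := hW.selfAdj h p.left_mem
  have sk := hW.selfAdj k p.right_mem
  obtain ⟨w, hb⟩ := exists_linearIndependent_triple p.indep
  have hinj : ∀ x, herm x (k f) = 0 → herm x (h w) = 0 → herm x (k w) = 0 → x = 0 := by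
    intro x h1 h2 h3
    refine p.eq_zero hW (eq_zero_of_orthogonal_basis hb ?_ ?_ ?_)
      (eq_zero_of_orthogonal_basis hb ?_ ?_ ?_)
    · rw [sh, p.left_focus, herm_zero_right]
    · rw [sh, p.cross, herm_neg_right, h1, neg_zero]
    · rw [sh, h2]
    · rw [sk, h1]
    · rw [sk, p.right_focus, herm_zero_right]
    · rw [sk, h3]
  obtain ⟨x, h1, h2, h3⟩ := exists_herm_eq hinj (-herm (m g) f) (-herm (m f) w) (-herm (m g) w)
  have hff := hW.herm_ker p.left_mem hm p.left_ne p.left_focus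
  have hgg := hW.herm_ker p.right_mem hm p.right_ne p.right_focus
  have hfg := p.herm_add_herm hW hm
  refine ⟨x, eq_neg_of_add_eq_zero_left (eq_zero_of_orthogonal_basis hb ?_ ?_ ?_),
    eq_neg_of_add_eq_zero_left (eq_zero_of_orthogonal_basis hb ?_ ?_ ?_)⟩ <;>
    simp only [herm_add_left]
  · rw [sh, p.left_focus, herm_zero_right, hff, add_zero]
  · rw [sh, p.cross, herm_neg_right, h1, ← hfg]; ring
  · rw [sh, h2]; ring
  · rw [sk, h1]; ring
  · rw [sk, p.right_focus, herm_zero_right, hgg, add_zero]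
  · rw [sk, h3]; ring

/-- If the solution lies in `ℂf + ℂg`, then `m` maps this slice into the line of `k f`, which is
orthogonal to it. -/
lemma images_of_comb (p : FocalPair W h k f g) {m : Module.End ℂ V3} {a b : ℂ}
    (hx : h (a • f + b • g) = -m f) (kx : k (a • f + b • g) = -m g) :
    m f = b • k f ∧ m g = (-a) • k f := by
  simp only [map_add, map_smul, p.left_focus, p.right_focus, p.cross, smul_zero, zero_add,
    add_zero] at hx kx
  constructor
  · rw [← neg_inj, ← hx, smul_neg]
  · rw [← neg_inj, ← kx, neg_smul, neg_neg]

lemma solution_focus (p : FocalPair W h k f g) (hW : IsRankTwoFamily W)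
    {m : Module.End ℂ V3} (hm : m ∈ W) {x : V3} (hx : h x = -m f) (kx : k x = -m g) :
    m x = 0 := by
  rcases eq_or_ne m 0 with rfl | m0
  · rfl
  have sh := hW.selfAdj h p.left_mem
  have sk := hW.selfAdj k p.right_mem
  have sm := hW.selfAdj m hm
  obtain ⟨q, hq0, hq⟩ := exists_ker_of_det_eq_zero (hW.det_eq m hm)
  by_cases hcomb : ∃ a b : ℂ, q = a • f + b • g
  · obtain ⟨a, b, rfl⟩ := hcomb
    have hff := hW.herm_ker p.left_mem hm p.left_ne p.left_focus
    have hgg := hW.herm_ker p.right_mem hm p.right_ne p.right_focus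
    have hfg : herm (m f) g = 0 := by
      have h1 := congrArg (herm · f) hq
      have h2 := congrArg (herm · g) hq
      simp [herm_add_left, herm_smul_left, hff, hgg] at h1 h2
      rcases h1 with rfl | h1
      · rcases h2 with rfl | h2
        · simp at hq0
        · exact h2
      · exact herm_eq_zero_symm (by rwa [← sm])
    obtain ⟨c, d, rfl⟩ := exists_comb_of_orthogonal p.indep p.cross_ne (p.cross_left hW)
      (p.cross_right hW) (x := x) (by
        have h1 : herm (h x) g = 0 := by rw [hx, herm_neg_left, hfg, neg_zero]
        rw [sh, p.cross, herm_neg_right, neg_eq_zero] at h1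
        exact herm_eq_zero_symm h1)
    obtain ⟨h1, h2⟩ := p.images_of_comb hx kx
    rw [map_add, map_smul, map_smul, h1, h2, smul_smul, smul_smul, ← add_smul]
    simp [mul_comm]
  · push Not at hcomb
    have hb := linearIndependent_triple_of_not_comb p.indep hcomb
    have hn : herm (k f) q ≠ 0 := fun h0 =>
      p.cross_ne (eq_zero_of_orthogonal_basis hb (p.cross_left hW) (p.cross_right hW) h0)
    have hhq := hW.herm_ker hm p.left_mem m0 hq
    have hkq := hW.herm_ker hm p.right_mem m0 hq
    obtain ⟨a, b, c, rfl⟩ := exists_coords hb x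
    have h1 := congrArg (herm · q) hx
    have h2 := congrArg (herm · q) kx
    simp [herm_add_left, herm_smul_left, herm_neg_left, p.left_focus, p.right_focus, p.cross,
      hhq, hkq, sm _ q, hq, hn] at h1 h2
    simp [h1, h2, hq]

end FocalPair

/-- A nonconfocal family carries a focal embedding, determined by two members with distinct
foci. -/
lemma FocalPair.exists_focal_embedding {W : Submodule ℝ (Module.End ℂ V3)}
    {h k : Module.End ℂ V3} {f g : V3} (p : FocalPair W h k f g) (hW : IsRankTwoFamily W) :
    ∃ F : W →ₗ[ℝ] V3, (∀ m : W, h (F m) = -(m : Module.End ℂ V3) f) ∧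
      ∀ m : W, k (F m) = -(m : Module.End ℂ V3) g := by
  choose F hF kF using fun m : W => p.exists_solution hW m.2
  have uniq : ∀ x y, h x = h y → k x = k y → x = y := fun x y h1 h2 =>
    sub_eq_zero.1 (p.eq_zero hW (by rw [map_sub, h1, sub_self]) (by rw [map_sub, h2, sub_self]))
  refine ⟨{ toFun := F, map_add' := fun m n => uniq _ _ ?_ ?_,
            map_smul' := fun t m => uniq _ _ ?_ ?_ }, hF, kF⟩
  · simp only [map_add, hF, Submodule.coe_add, LinearMap.add_apply, neg_add]
  · simp only [map_add, kF, Submodule.coe_add, LinearMap.add_apply, neg_add]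
  · simp [hF, ← Complex.coe_smul]
  · simp [kF, ← Complex.coe_smul]

lemma herm_sum_left {ι : Type*} (s : Finset ι) (x : ι → V3) (y : V3) :
    herm (∑ i ∈ s, x i) y = ∑ i ∈ s, herm (x i) y :=
  map_sum (AddMonoidHom.mk' (herm · y) fun a b => herm_add_left a b y) x s

lemma herm_sum_right {ι : Type*} (s : Finset ι) (x : V3) (y : ι → V3) :
    herm x (∑ i ∈ s, y i) = ∑ i ∈ s, herm x (y i) :=
  map_sum (AddMonoidHom.mk' (herm x ·) (herm_add_right x)) y s

section DualBasis

variable (b : Module.Basis (Fin 3) ℂ V3) {n : Fin 3 → V3} {w : ℂ}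

lemma herm_dual_eq (hn : ∀ i j, herm (b i) (n j) = if i = j then w else 0)
    (y : V3) (j : Fin 3) : herm y (n j) = b.repr y j * w := by
  conv_lhs => rw [← b.sum_repr y, herm_sum_left]
  simp [herm_smul_left, hn]

lemma trace_eq_sum_herm_dual (hn : ∀ i j, herm (b i) (n j) = if i = j then w else 0)
    (h : Module.End ℂ V3) :
    LinearMap.trace ℂ V3 h * w = ∑ j, herm (h (b j)) (n j) := by
  rw [LinearMap.trace_eq_matrix_trace ℂ b]
  simp [Matrix.trace, LinearMap.toMatrix_apply, herm_dual_eq b hn, Finset.sum_mul]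

/-- If a basis dual to `b` (up to a scalar) has real Gram matrix, so does `b`. -/
lemma conj_herm_basis_of_dual (hn : ∀ i j, herm (b i) (n j) = if i = j then w else 0)
    (hw : w ≠ 0)
    (hreal : ∀ i j, conj (herm (n i) (n j)) = herm (n i) (n j))
    (i j : Fin 3) : conj (herm (b i) (b j)) = herm (b i) (b j) := by
  set G : Matrix (Fin 3) (Fin 3) ℂ := .of fun i j => herm (b i) (b j) with hG
  set N : Matrix (Fin 3) (Fin 3) ℂ := .of fun i j => (w * conj w)⁻¹ * herm (n i) (n j) with hN
  have hw' : conj w ≠ 0 := (map_ne_zero _).2 hw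
  have hGN : G * N = 1 := by
    ext i k
    have h1 : herm (b i) (n k) = ∑ j, conj (b.repr (n k) j) * herm (b i) (b j) := by
      conv_lhs => rw [← b.sum_repr (n k), herm_sum_right]
      simp [herm_smul_right]
    have h2 : ∀ j, herm (n j) (n k) = conj (b.repr (n k) j) * conj w := fun j => by
      rw [← conj_herm, herm_dual_eq b hn, map_mul]
    have h3 : (G * N) i k = w⁻¹ * herm (b i) (n k) := by
      rw [h1, Matrix.mul_apply, Finset.mul_sum]
      refine Finset.sum_congr rfl fun j _ => ?_
      simp only [hG, hN, Matrix.of_apply, h2]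
      field_simp
    rw [h3, hn, Matrix.one_apply]
    split_ifs <;> simp [hw]
  have hGN' : G.map conj * N = 1 := by
    have hNc : N.map conj = N := by
      ext i j
      simp only [hN, Matrix.map_apply, Matrix.of_apply, map_mul, map_inv₀, hreal,
        Complex.conj_conj, mul_comm]
    have := congrArg (Matrix.map · (starRingEnd ℂ)) hGN
    simpa [Matrix.map_mul, hNc] using this
  have hNG : N * G = 1 := mul_eq_one_comm.1 hGN
  have : G.map conj = G := by
    calc G.map conj = G.map conj * (N * G) := by rw [hNG, mul_one]
      _ = G := by rw [← mul_assoc, hGN', one_mul]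
  exact congrFun (congrFun this i) j

end DualBasis

section FocalEmbedding

variable {W : Submodule ℝ (Module.End ℂ V3)} {F : W →ₗ[ℝ] V3}

lemma focal_polar (hF : ∀ m : W, (m : Module.End ℂ V3) (F m) = 0) (m n : W) :
    (m : Module.End ℂ V3) (F n) = -(n : Module.End ℂ V3) (F m) := by
  have h := hF (m + n)
  simp only [map_add, Submodule.coe_add, LinearMap.add_apply, hF, zero_add, add_zero] at h
  exact eq_neg_of_add_eq_zero_left ((add_comm _ _).trans h)

lemma conj_focal_form (hF : ∀ m : W, (m : Module.End ℂ V3) (F m) = 0)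
    (hs : ∀ h ∈ W, SelfAdj h) (m n l : W) :
    conj (herm ((m : Module.End ℂ V3) (F n)) (F l)) =
      -herm ((m : Module.End ℂ V3) (F n)) (F l) := by
  have adj : ∀ a b c : W, conj (herm ((a : Module.End ℂ V3) (F b)) (F c)) =
      herm ((a : Module.End ℂ V3) (F c)) (F b) := fun a b c => by rw [conj_herm, hs a a.2]
  have pol : ∀ a b c : W, herm ((a : Module.End ℂ V3) (F b)) (F c) =
      -herm ((b : Module.End ℂ V3) (F a)) (F c) := fun a b c => by
    rw [focal_polar hF, herm_neg_left]
  rw [adj, pol, ← adj, pol, map_neg, neg_neg, adj, pol]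

lemma focal_form_swap (hF : ∀ m : W, (m : Module.End ℂ V3) (F m) = 0)
    (hs : ∀ h ∈ W, SelfAdj h) (m n l : W) :
    herm ((m : Module.End ℂ V3) (F n)) (F l) =
    -herm ((m : Module.End ℂ V3) (F l)) (F n) := by
  rw [← conj_focal_form hF hs m l n, conj_herm, hs m m.2]

lemma focal_form_self (hF : ∀ m : W, (m : Module.End ℂ V3) (F m) = 0)
    (hs : ∀ h ∈ W, SelfAdj h) (m n : W) :
    herm ((m : Module.End ℂ V3) (F n)) (F n) = 0 := by
  have := focal_form_swap hF hs m n n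
  exact self_eq_neg.1 this

lemma focal_form_rotate (hF : ∀ m : W, (m : Module.End ℂ V3) (F m) = 0)
    (hs : ∀ h ∈ W, SelfAdj h) (m n l : W) :
    herm ((m : Module.End ℂ V3) (F n)) (F l) =
    herm ((n : Module.End ℂ V3) (F l)) (F m) := by
  rw [focal_form_swap hF hs n, focal_polar hF, herm_neg_left]

/-- If the image of a focal embedding spans `V`, then the family is three-dimensional and the
image is totally real. -/
lemma totally_real_of_spanning (hF : ∀ m : W, (m : Module.End ℂ V3) (F m) = 0)
    (hW : IsRankTwoFamily W) (hinj : Function.Injective F)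
    {e : Fin 3 → W} (he : LinearIndependent ℂ fun i => F (e i)) :
    Module.finrank ℝ W = 3 ∧ ∀ m m' : W, (herm (F m) (F m')).im = 0 := by
  have hs := hW.selfAdj
  set b := basisOfLinearIndependentOfCardEqFinrank he (by simp) with hb_def
  have hb : ∀ i, b i = F (e i) := fun i => by simp [hb_def]
  set n : Fin 3 → V3 := fun i => (e (i + 1) : Module.End ℂ V3) (F (e (i + 2))) with hn_def
  set w := herm (F (e 0)) (n 0) with hw_def
  have hconj : ∀ m i, conj (herm (F m) (n i)) = -herm (F m) (n i) := fun m i => by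
    have h1 := conj_focal_form hF hs (e (i + 1)) (e (i + 2)) m
    rw [conj_herm] at h1 ⊢
    rw [h1, neg_neg]
  have hn : ∀ i j, herm (b i) (n j) = if i = j then w else 0 := by
    have hr : ∀ i j, herm (b i) (n j) =
        -herm ((e (j + 1) : Module.End ℂ V3) (F (e (j + 2)))) (F (e i)) := fun i j => by
      rw [hb, ← conj_focal_form hF hs, conj_herm]
    have h0 := hr 0 0
    rw [hb, ← hw_def] at h0
    have r1 := focal_form_rotate hF hs (e 2) (e 0) (e 1)
    have r2 := focal_form_rotate hF hs (e 0) (e 1) (e 2)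
    have s1 := fun m n => focal_form_self hF hs m n
    have s2 : ∀ m n : W, herm ((m : Module.End ℂ V3) (F n)) (F m) = 0 := fun m n => by
      rw [focal_polar hF, herm_neg_left, s1, neg_zero]
    intro i j
    rw [hr, h0]
    fin_cases i <;> fin_cases j <;> simp [s1, s2, r1, r2]
  have hw : w ≠ 0 := by
    intro hw
    have hn0 : n 0 = 0 := eq_zero_of_herm_eq_zero fun y => by
      rw [← conj_herm, herm_dual_eq b hn, hw, mul_zero, map_zero]
    have hne : (e 1 : Module.End ℂ V3) ≠ 0 := by
      intro h0
      have : e 1 = 0 := Subtype.ext h0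
      exact he.ne_zero 1 (by simp [this])
    obtain ⟨c, hc⟩ := hW.ker_line _ (e 1).2 hne _ (he.ne_zero 1) (hF _) _ hn0
    have := Fintype.linearIndependent_iff.1 he ![0, c, -1] (by
      simp [Fin.sum_univ_three, ← hc]) 2
    simp at this
  have hwc : conj w = -w := hconj _ _
  have hN : ∀ i, conj (herm (n (i + 1)) (n (i + 2))) = herm (n (i + 1)) (n (i + 2)) := by
    intro i
    have ht := trace_eq_sum_herm_dual b hn (e i : Module.End ℂ V3)
    rw [hW.trace_eq _ (e i).2, zero_mul] at ht
    have h1 : (e i : Module.End ℂ V3) (F (e (i + 1))) = n (i + 2) := by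
      simp only [hn_def]
      congr 3 <;> fin_cases i <;> rfl
    have h2 : (e i : Module.End ℂ V3) (F (e (i + 2))) = -n (i + 1) := by
      rw [focal_polar hF]
      simp only [hn_def]
      congr 4 <;> fin_cases i <;> rfl
    have hsum : ∀ φ : Fin 3 → ℂ, ∑ j, φ j = φ i + φ (i + 1) + φ (i + 2) := fun φ => by
      rw [Fin.sum_univ_three]
      fin_cases i <;> simp <;> ring
    rw [hsum] at ht
    simp only [hb, hF, h1, h2, herm_zero_left, herm_neg_left] at ht
    rw [conj_herm]
    linear_combination -ht
  have hreal : ∀ i j, conj (herm (n i) (n j)) = herm (n i) (n j) := by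
    have hN' : ∀ i, conj (herm (n (i + 2)) (n (i + 1))) = herm (n (i + 2)) (n (i + 1)) :=
      fun i => (conj_herm _ _).trans ((hN i).symm.trans (conj_herm _ _))
    have h0 := hN 0
    have h1 := hN 1
    have h2 := hN 2
    have h0' := hN' 0
    have h1' := hN' 1
    have h2' := hN' 2
    intro i j
    fin_cases i <;> fin_cases j <;> first | exact conj_herm _ _ | assumption
  have hcoord : ∀ (m : W) i, conj (b.repr (F m) i) = b.repr (F m) i := by
    intro m i
    have h1 := hconj m i
    rw [herm_dual_eq b hn, map_mul, hwc, mul_neg, neg_inj] at h1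
    exact mul_right_cancel₀ hw h1
  have hsum : ∀ m : W, m = ∑ i, (b.repr (F m) i).re • e i := by
    intro m
    apply hinj
    rw [map_sum]
    conv_lhs => rw [← b.sum_repr (F m)]
    refine Finset.sum_congr rfl fun i _ => ?_
    rw [map_smul, ← Complex.coe_smul, Complex.conj_eq_iff_re.1 (hcoord m i), hb]
  constructor
  · have hli : LinearIndependent ℝ e := .of_comp F (he.restrict_scalars' ℝ)
    have hsp : ⊤ ≤ Submodule.span ℝ (Set.range e) := fun m _ => by
      rw [hsum m]
      exact Submodule.sum_mem _ fun i _ =>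
        Submodule.smul_mem _ _ (Submodule.subset_span ⟨i, rfl⟩)
    simpa using Module.finrank_eq_card_basis (Module.Basis.mk hli hsp)
  · intro m m'
    rw [hsum m, hsum m', map_sum, map_sum, herm_sum_left]
    simp only [herm_sum_right, map_smul, ← Complex.coe_smul, herm_smul_left, herm_smul_right,
      Complex.conj_ofReal, Complex.im_sum, Complex.im_ofReal_mul]
    refine Finset.sum_eq_zero fun i _ => Finset.sum_eq_zero fun j _ => ?_
    have := conj_herm_basis_of_dual b hn hw hreal i j
    rw [hb, hb, Complex.conj_eq_iff_im] at this
    simp [this]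

end FocalEmbedding

/-- a nonconfocal linear family of bisectors admits an essentially unique
focal embedding `f : W ↪ V`, and either `fW` spans `V` (then `dim_ℝ W = 3` and `fW` is
totally real) or `U := ℂ·fW` is `2`-dimensional and the family shares the slice `ℙ(U)`. -/
theorem stmt_1 (W : Submodule ℝ (Module.End ℂ V3)) (hW : IsLinearFamily W)
    (hnc : ∀ f₀ : V3, f₀ ≠ 0 → ∃ h ∈ W, h f₀ ≠ 0) :
    ∃ f : W →ₗ[ℝ] V3, Function.Injective f ∧
      (∀ h : W, (h : Module.End ℂ V3) (f h) = 0) ∧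
      (∀ f' : W →ₗ[ℝ] V3, f' ≠ 0 → (∀ h : W, (h : Module.End ℂ V3) (f' h) = 0) →
        ∃ c : ℂ, c ≠ 0 ∧ ∀ h : W, f' h = c • f h) ∧
      ((Submodule.span ℂ (Set.range f) = ⊤ ∧ Module.finrank ℝ W = 3 ∧
          ∀ h h' : W, (herm (f h) (f h')).im = 0) ∨
        (Module.finrank ℂ (Submodule.span ℂ (Set.range f)) = 2 ∧
          ∀ h : W, ∀ u ∈ Submodule.span ℂ (Set.range f),
            ∀ u' ∈ Submodule.span ℂ (Set.range f),
              herm ((h : Module.End ℂ V3) u) u' = 0)) := by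
  have hW := hW.isRankTwoFamily
  obtain ⟨h, k, f, g, p⟩ := hW.exists_focalPair hnc
  obtain ⟨F, hF, kF⟩ := p.exists_focal_embedding hW
  have focus : ∀ m : W, (m : Module.End ℂ V3) (F m) = 0 := fun m =>
    p.solution_focus hW m.2 (hF m) (kF m)
  have ext_pair : ∀ x y, h x = h y → k x = k y → x = y := fun x y h1 h2 =>
    sub_eq_zero.1 (p.eq_zero hW (by rw [map_sub, h1, sub_self]) (by rw [map_sub, h2, sub_self]))
  have hinj : Function.Injective F := by
    suffices hker : ∀ m, F m = 0 → m = 0 from fun m n hmn =>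
      sub_eq_zero.1 (hker _ (by rw [map_sub, hmn, sub_self]))
    intro m hm
    have mf := hF m
    have mg := kF m
    rw [hm, map_zero, eq_comm, neg_eq_zero] at mf mg
    by_contra hne
    obtain ⟨c, hc⟩ := hW.ker_line m m.2 (fun h0 => hne (Subtype.ext h0)) f p.focus_ne mf g mg
    exact (LinearIndependent.pair_iff' p.focus_ne).1 p.indep c hc.symm
  have Fh : F ⟨h, p.left_mem⟩ = f := ext_pair _ _
    (by rw [hF, p.left_focus, neg_zero]) (by rw [kF, p.cross, neg_neg])
  have Fk : F ⟨k, p.right_mem⟩ = g := ext_pair _ _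
    (by rw [hF, p.cross]) (by rw [kF, p.right_focus, neg_zero])
  refine ⟨F, hinj, focus, fun F' hF'0 hF' => ?_, ?_⟩
  · obtain ⟨a, ha⟩ := hW.ker_line h p.left_mem p.left_ne f p.focus_ne p.left_focus _
      (hF' ⟨h, p.left_mem⟩)
    have hg0 : g ≠ 0 := p.indep.ne_zero 1
    obtain ⟨b, hb⟩ := hW.ker_line k p.right_mem p.right_ne g hg0 p.right_focus _
      (hF' ⟨k, p.right_mem⟩)
    have hab : b = a := by
      have h1 := focal_polar hF' ⟨h, p.left_mem⟩ ⟨k, p.right_mem⟩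
      simp only [ha, hb, map_smul, p.cross, smul_neg, neg_inj] at h1
      exact smul_left_injective ℂ p.cross_ne h1
    subst hab
    have hEq : ∀ m : W, F' m = b • F m := by
      intro m
      have h1 := focal_polar hF' ⟨h, p.left_mem⟩ m
      have h2 := focal_polar hF' ⟨k, p.right_mem⟩ m
      simp only [ha, hb, map_smul] at h1 h2
      exact ext_pair _ _ (by rw [h1, map_smul, hF, smul_neg]) (by rw [h2, map_smul, kF, smul_neg])
    refine ⟨b, ?_, hEq⟩
    rintro rfl
    exact hF'0 (LinearMap.ext fun m => by simp [hEq])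
  · by_cases hcomb : ∀ m : W, ∃ a b : ℂ, F m = a • f + b • g
    · right
      have hspan : Submodule.span ℂ (Set.range F) = Submodule.span ℂ (Set.range ![f, g]) := by
        apply le_antisymm <;> rw [Submodule.span_le]
        · rintro _ ⟨m, rfl⟩
          obtain ⟨a, b, hab⟩ := hcomb m
          exact (Submodule.mem_span_range_iff_exists_fun ℂ).2 ⟨![a, b], by
            simp [Fin.sum_univ_two, hab]⟩
        · rintro _ ⟨i, rfl⟩
          fin_cases i
          · exact Submodule.subset_span ⟨_, Fh⟩
          · exact Submodule.subset_span ⟨_, Fk⟩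
      refine ⟨by rw [hspan, finrank_span_eq_card p.indep, Fintype.card_fin],
        fun m u hu u' hu' => ?_⟩
      rw [hspan] at hu hu'
      obtain ⟨c, rfl⟩ := (Submodule.mem_span_range_iff_exists_fun ℂ).1 hu
      obtain ⟨d, rfl⟩ := (Submodule.mem_span_range_iff_exists_fun ℂ).1 hu'
      obtain ⟨a, b, hab⟩ := hcomb m
      obtain ⟨mf, mg⟩ := p.images_of_comb (hab ▸ hF m) (hab ▸ kF m)
      simp [Fin.sum_univ_two, herm_add_left, herm_add_right, herm_smul_left, herm_smul_right,
        mf, mg, herm_neg_left, p.cross_left hW, p.cross_right hW]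
    · left
      push Not at hcomb
      obtain ⟨m, hm⟩ := hcomb
      have hli := linearIndependent_triple_of_not_comb p.indep hm
      have he : (fun i => F (![⟨h, p.left_mem⟩, ⟨k, p.right_mem⟩, m] i)) = ![f, g, F m] := by
        ext1 i
        fin_cases i
        · exact Fh
        · exact Fk
        · rfl
      obtain ⟨hdim, hreal⟩ := totally_real_of_spanning focus hW hinj (he ▸ hli)
      refine ⟨top_le_iff.1 ?_, hdim, hreal⟩
      rw [← hli.span_eq_top_of_card_eq_finrank' (by simp), ← he, Submodule.span_le]
      rintro _ ⟨i, rfl⟩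
      exact Submodule.subset_span ⟨_, rfl⟩

end
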